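/- arXiv:2112.09874 — 2 statements merged into one kernel-verified Lean document; each statement's English description precedes it below -/
import Mathlib

section
/- Let m > 0 be an even integer, let T be an essentially small triangulated category whose suspension functor Σ satisfies Σ^m ≅ Id_T as additive functors, let A be an abelian category, and let F : T → A be a cohomological functor. Then the assignment [X] ↦ Σ_{i=0}^{m−1} (−1)^i [F(Σ^i X)] extends to a well-defined group homomorphism K_0(T) → K_0(A). -/
open CategoryTheory CategoryTheory.Limits CategoryTheory.Pretriangulated

universe v u

attribute [local instance] CategoryTheory.isIsomorphicSetoid

/-- The isomorphism class of an object. -/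
noncomputable def isoClass {C : Type u} [Category.{v} C] (X : C) :
    Quotient (CategoryTheory.isIsomorphicSetoid C) :=
  Quotient.mk _ X

/-- The Grothendieck group of an abelian category: the free abelian group on
isomorphism classes of objects modulo the relations `[X₁] - [X₂] + [X₃] = 0`
for every short exact sequence `0 → X₁ → X₂ → X₃ → 0`. -/
noncomputable def K0Ab (A : Type u) [Category.{v} A] [Abelian A] : Type u :=
  FreeAbelianGroup (Quotient (CategoryTheory.isIsomorphicSetoid A)) ⧸
    AddSubgroup.closure
      {x | ∃ S : ShortComplex A, S.ShortExact ∧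
        x = FreeAbelianGroup.of (isoClass S.X₁) - FreeAbelianGroup.of (isoClass S.X₂) +
          FreeAbelianGroup.of (isoClass S.X₃)}

noncomputable instance (A : Type u) [Category.{v} A] [Abelian A] :
    AddCommGroup (K0Ab A) :=
  QuotientAddGroup.Quotient.addCommGroup _

/-- The class of an object in the Grothendieck group of an abelian category. -/
noncomputable def K0Ab.mk {A : Type u} [Category.{v} A] [Abelian A] (X : A) : K0Ab A :=
  QuotientAddGroup.mk (FreeAbelianGroup.of (isoClass X))

section Triangulated

variable (T : Type u) [Category.{v} T] [HasZeroObject T] [Preadditive T] [HasShift T ℤ]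
  [∀ n : ℤ, (shiftFunctor T n).Additive] [Pretriangulated T]

/-- The Grothendieck group of a (pre)triangulated category: the free abelian group on
isomorphism classes of objects modulo the relations `[X] - [Y] + [Z] = 0` for every
distinguished triangle `X → Y → Z → ΣX`. -/
noncomputable def K0Tri : Type u :=
  FreeAbelianGroup (Quotient (CategoryTheory.isIsomorphicSetoid T)) ⧸
    AddSubgroup.closure
      {x | ∃ Tr : Triangle T, Tr ∈ distinguishedTriangles ∧
        x = FreeAbelianGroup.of (isoClass Tr.obj₁) - FreeAbelianGroup.of (isoClass Tr.obj₂) +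
          FreeAbelianGroup.of (isoClass Tr.obj₃)}

noncomputable instance : AddCommGroup (K0Tri T) :=
  QuotientAddGroup.Quotient.addCommGroup _

variable {T}

/-- The class of an object in the Grothendieck group of a triangulated category. -/
noncomputable def K0Tri.mk (X : T) : K0Tri T :=
  QuotientAddGroup.mk (FreeAbelianGroup.of (isoClass X))

end Triangulated

theorem K0Ab.mk_eq_of_iso {A : Type u} [Category.{v} A] [Abelian A] {X Y : A} (e : X ≅ Y) :
    K0Ab.mk X = K0Ab.mk Y := by
  have : isoClass X = isoClass Y := Quotient.sound ⟨e⟩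
  unfold K0Ab.mk
  rw [this]

theorem K0Ab.mk_shortExact {A : Type u} [Category.{v} A] [Abelian A] (S : ShortComplex A)
    (hS : S.ShortExact) : K0Ab.mk S.X₂ = K0Ab.mk S.X₁ + K0Ab.mk S.X₃ := by
  have h : K0Ab.mk S.X₁ - K0Ab.mk S.X₂ + K0Ab.mk S.X₃ = 0 :=
    (QuotientAddGroup.eq_zero_iff
      (FreeAbelianGroup.of (isoClass S.X₁) - FreeAbelianGroup.of (isoClass S.X₂) +
          FreeAbelianGroup.of (isoClass S.X₃))).2 (AddSubgroup.subset_closure ⟨S, hS, rfl⟩)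
  have h2 : K0Ab.mk S.X₁ + K0Ab.mk S.X₃ - K0Ab.mk S.X₂ = 0 := by rw [← h]; abel
  exact (sub_eq_zero.1 h2).symm

theorem K0Ab.mk_exact {A : Type u} [Category.{v} A] [Abelian A] {X Y Z : A}
    (f : X ⟶ Y) (g : Y ⟶ Z) (w : f ≫ g = 0) (h : (ShortComplex.mk f g w).Exact) :
    K0Ab.mk X = K0Ab.mk (kernel f) + K0Ab.mk (kernel g) := by
  have he : Epi (kernel.lift g f w) := (ShortComplex.exact_iff_epi_kernel_lift _).1 h
  have w' : kernel.ι f ≫ kernel.lift g f w = 0 := by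
    rw [← cancel_mono (kernel.ι g)]; simp
  refine K0Ab.mk_shortExact (ShortComplex.mk (kernel.ι f) (kernel.lift g f w) w') ?_
  have hex : (ShortComplex.mk (kernel.ι f) (kernel.lift g f w) w').Exact := by
    apply ShortComplex.exact_of_f_is_kernel
    refine KernelFork.IsLimit.ofι' _ _ (fun {W} k hk => ⟨kernel.lift f k ?_, kernel.lift_ι _ _ _⟩)
    have := congrArg (fun t => t ≫ kernel.ι g) hk
    simpa using this
  exact { exact := hex, mono_f := by dsimp; infer_instance, epi_g := he }

theorem alt_sum_telescope {G : Type*} [AddCommGroup G] (a : ℕ → G) (m : ℕ) :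
    ∑ i ∈ Finset.range m, ((-1 : ℤ) ^ i) • (a i + a (i + 1)) = a 0 - ((-1 : ℤ) ^ m) • a m := by
  induction m with
  | zero => simp
  | succ n ih =>
    rw [Finset.sum_range_succ, ih, pow_succ, smul_add, mul_neg, mul_one, neg_smul]
    abel

theorem alt_sum_triangle
    {T : Type u} [Category.{v} T] [HasZeroObject T] [Preadditive T] [HasShift T ℤ]
    [∀ n : ℤ, (shiftFunctor T n).Additive] [Pretriangulated T]
    {A : Type*} [Category A] [Abelian A]
    (F : T ⥤ A) [F.IsHomological] (Tr : Triangle T) (hT : Tr ∈ distinguishedTriangles) (i : ℕ) :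
    K0Ab.mk (F.obj (Tr.obj₁⟦(i : ℤ)⟧)) - K0Ab.mk (F.obj (Tr.obj₂⟦(i : ℤ)⟧))
      + K0Ab.mk (F.obj (Tr.obj₃⟦(i : ℤ)⟧)) =
    K0Ab.mk (kernel (F.map (Tr.mor₁⟦(i : ℤ)⟧'))) +
      K0Ab.mk (kernel (F.map (Tr.mor₁⟦((i + 1 : ℕ) : ℤ)⟧'))) := by
  letI : F.ShiftSequence ℤ := Functor.ShiftSequence.tautological F ℤ
  have h : (i : ℤ) + 1 = ((i + 1 : ℕ) : ℤ) := by push_cast; rfl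
  have h2 := K0Ab.mk_exact _ _ _ (F.homologySequence_exact₂ Tr hT i)
  have h3 := K0Ab.mk_exact _ _ _ (F.homologySequence_exact₃ Tr hT _ _ h)
  have h1 := K0Ab.mk_exact _ _ _ (F.homologySequence_exact₁ Tr hT _ _ h)
  change K0Ab.mk (F.obj (Tr.obj₁⟦(i : ℤ)⟧)) =
    K0Ab.mk (kernel (F.map (Tr.mor₁⟦(i : ℤ)⟧'))) + _ at h2
  change K0Ab.mk (F.obj (Tr.obj₂⟦(i : ℤ)⟧)) = _ at h3
  change K0Ab.mk (F.obj (Tr.obj₃⟦(i : ℤ)⟧)) = _ +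
    K0Ab.mk (kernel (F.map (Tr.mor₁⟦((i + 1 : ℕ) : ℤ)⟧'))) at h1
  rw [h1, h2, h3]
  abel

/-- Let `m > 0` be an even integer, `T` an essentially small triangulated
category with `Σ^m ≅ Id` as (additive) functors, `A` an abelian category and `F : T ⥤ A`
a cohomological functor.  Then `[X] ↦ ∑_{i=0}^{m-1} (-1)^i [F(Σ^i X)]` extends to a
well-defined group homomorphism `K₀(T) → K₀(A)`. -/
theorem even_periodic_cohomological_functor_induces_hom_on_K0
    {T : Type u} [Category.{v} T] [HasZeroObject T] [Preadditive T] [HasShift T ℤ]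
    [∀ n : ℤ, (shiftFunctor T n).Additive] [Pretriangulated T] [EssentiallySmall.{0} T]
    {A : Type*} [Category A] [Abelian A]
    (m : ℕ) (hm₀ : 0 < m) (hm : Even m)
    (e : shiftFunctor T (m : ℤ) ≅ 𝟭 T)
    (F : T ⥤ A) [F.IsHomological] :
    ∃ φ : K0Tri T →+ K0Ab A,
      ∀ X : T, φ (K0Tri.mk X) =
        ∑ i ∈ Finset.range m, ((-1 : ℤ) ^ i) • K0Ab.mk (F.obj (X⟦(i : ℤ)⟧)) := by
  classical
  let f : T → K0Ab A := fun X =>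
    ∑ i ∈ Finset.range m, ((-1 : ℤ) ^ i) • K0Ab.mk (F.obj (X⟦(i : ℤ)⟧))
  have hf : ∀ X Y : T, IsIsomorphic X Y → f X = f Y := by
    rintro X Y ⟨g⟩
    refine Finset.sum_congr rfl fun i _ => ?_
    rw [K0Ab.mk_eq_of_iso (F.mapIso ((shiftFunctor T (i : ℤ)).mapIso g))]
  let ψ : FreeAbelianGroup (Quotient (CategoryTheory.isIsomorphicSetoid T)) →+ K0Ab A :=
    FreeAbelianGroup.lift (Quotient.lift f hf)
  have hψ : ∀ X : T, ψ (FreeAbelianGroup.of (isoClass X)) = f X := fun X =>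
    FreeAbelianGroup.lift_apply_of _ _
  refine ⟨QuotientAddGroup.lift _ ψ ?_, fun X => hψ X⟩
  rw [AddSubgroup.closure_le]
  rintro x ⟨Tr, hT, rfl⟩
  change ψ _ = 0
  rw [map_add, map_sub, hψ, hψ, hψ]
  let a : ℕ → K0Ab A := fun i => K0Ab.mk (kernel (F.map (Tr.mor₁⟦(i : ℤ)⟧')))
  have key : f Tr.obj₁ - f Tr.obj₂ + f Tr.obj₃ =
      ∑ i ∈ Finset.range m, ((-1 : ℤ) ^ i) • (a i + a (i + 1)) := by
    simp only [f, a]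
    rw [← Finset.sum_sub_distrib, ← Finset.sum_add_distrib]
    refine Finset.sum_congr rfl fun i _ => ?_
    rw [← alt_sum_triangle F Tr hT i, smul_add, smul_sub]
  rw [key, alt_sum_telescope, hm.neg_one_pow, one_smul, sub_eq_zero]
  let E : shiftFunctor T ((0 : ℕ) : ℤ) ≅ shiftFunctor T (m : ℤ) :=
    shiftFunctorZero' T _ (by simp) ≪≫ e.symm
  refine K0Ab.mk_eq_of_iso (kernel.mapIso _ _ (F.mapIso (E.app _)) (F.mapIso (E.app _)) ?_)
  simp only [Functor.mapIso_hom, Iso.app_hom, ← F.map_comp]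
  rw [E.hom.naturality]
end

section
/- Let T be a triangulated category, A an abelian category, F : T → A a cohomological functor, m a positive integer with F ∘ Σ^m ≅ F (for instance if Σ^m ≅ Id_T), and let X → Y → Z → ΣX be an exact triangle in T. Write F^i := F ∘ Σ^i, g : F^0(X) → F^0(Y) and f : F^{m−1}(Z) → F^m(X) ≅ F^0(X) for the maps induced by the triangle. Then in K_0(A) one has Σ_{i=0}^{m−1}(−1)^i[F^i(X)] − Σ_{i=0}^{m−1}(−1)^i[F^i(Y)] + Σ_{i=0}^{m−1}(−1)^i[F^i(Z)] = [Ker g] − (−1)^m [Im f]. -/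
open CategoryTheory CategoryTheory.Limits CategoryTheory.Pretriangulated

universe v u

attribute [local instance] CategoryTheory.isIsomorphicSetoid

theorem K0Ab.mk_kernel {A : Type u} [Category.{v} A] [Abelian A] {X Y K : A} (f : X ⟶ Y)
    (p : X ⟶ K) (i : K ⟶ Y) [Epi p] [Mono i] (h : p ≫ i = f) :
    K0Ab.mk X = K0Ab.mk (kernel f) + K0Ab.mk K := by
  subst h
  have w : kernel.ι (p ≫ i) ≫ p = 0 := by
    rw [← cancel_mono i, Category.assoc, kernel.condition, zero_comp]
  refine K0Ab.mk_shortExact (ShortComplex.mk _ _ w) ?_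
  have hex : (ShortComplex.mk _ _ w).Exact := by
    refine ShortComplex.exact_of_f_is_kernel _ ?_
    exact KernelFork.IsLimit.ofι _ _
      (fun k hk => kernel.lift _ k (by rw [← Category.assoc, hk, zero_comp]))
      (fun k hk => by simp)
      (fun k hk l hl => by
        rw [← cancel_mono (kernel.ι (p ≫ i))]; simpa using hl)
  exact { exact := hex, mono_f := by dsimp; infer_instance, epi_g := by dsimp; infer_instance }

theorem K0Ab.mk_kernel_comp_iso {A : Type u} [Category.{v} A] [Abelian A] {X Y Z : A} (f : X ⟶ Z)
    (d : X ⟶ Y) (i : Y ≅ Z) (h : f = d ≫ i.hom) : K0Ab.mk (kernel f) = K0Ab.mk (kernel d) := by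
  subst h
  exact K0Ab.mk_eq_of_iso (kernelCompMono _ _)

theorem K0Ab.telescope {G : Type*} [AddCommGroup G] (x y z k : ℕ → G)
    (h : ∀ n, x n - y n + z n = k n + k (n + 1)) (m : ℕ) :
    (∑ i ∈ Finset.range m, ((-1 : ℤ) ^ i) • x i) - (∑ i ∈ Finset.range m, ((-1 : ℤ) ^ i) • y i)
      + (∑ i ∈ Finset.range m, ((-1 : ℤ) ^ i) • z i) = k 0 - ((-1 : ℤ) ^ m) • k m := by
  rw [← Finset.sum_sub_distrib, ← Finset.sum_add_distrib]
  simp only [← smul_sub, ← smul_add, h]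
  induction m with
  | zero => simp
  | succ n ih => rw [Finset.sum_range_succ, ih, pow_succ]; simp; abel

/-- Let `F : T ⥤ A` be a cohomological functor from a triangulated
category to an abelian category, `m > 0` with `F ∘ Σ^m ≅ F`, and let
`X → Y → Z → ΣX` be a distinguished triangle.  With `g : F(X) → F(Y)` induced by the
triangle and `f : F(Σ^{m-1} Z) → F(Σ^m X) ≅ F(X)` the connecting map, one has
`∑_{i=0}^{m-1} (-1)^i [F(Σ^i X)] - ∑_{i=0}^{m-1} (-1)^i [F(Σ^i Y)]
  + ∑_{i=0}^{m-1} (-1)^i [F(Σ^i Z)] = [Ker g] - (-1)^m [Im f]` in `K₀(A)`. -/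
theorem cohomological_functor_alternating_sum_eq
    {T : Type u} [Category.{v} T] [HasZeroObject T] [Preadditive T] [HasShift T ℤ]
    [∀ n : ℤ, (shiftFunctor T n).Additive] [Pretriangulated T]
    {A : Type*} [Category A] [Abelian A]
    (F : T ⥤ A) [F.IsHomological]
    (m : ℕ) (hm₀ : 0 < m)
    (e : shiftFunctor T (m : ℤ) ⋙ F ≅ F)
    (Tr : Triangle T) (hTr : Tr ∈ distinguishedTriangles)
    (g : F.obj Tr.obj₁ ⟶ F.obj Tr.obj₂)
    (f : F.obj (Tr.obj₃⟦(m : ℤ) - 1⟧) ⟶ F.obj Tr.obj₁)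
    (hg : g = F.map Tr.mor₁)
    (hf : f = F.map ((Tr.mor₃⟦(m : ℤ) - 1⟧') ≫
        (shiftFunctorAdd' T 1 ((m : ℤ) - 1) (m : ℤ) (by ring)).inv.app Tr.obj₁) ≫
        e.hom.app Tr.obj₁) :
    (∑ i ∈ Finset.range m, ((-1 : ℤ) ^ i) • K0Ab.mk (F.obj (Tr.obj₁⟦(i : ℤ)⟧)))
      - (∑ i ∈ Finset.range m, ((-1 : ℤ) ^ i) • K0Ab.mk (F.obj (Tr.obj₂⟦(i : ℤ)⟧)))
      + (∑ i ∈ Finset.range m, ((-1 : ℤ) ^ i) • K0Ab.mk (F.obj (Tr.obj₃⟦(i : ℤ)⟧)))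
      = K0Ab.mk (kernel g) - ((-1 : ℤ) ^ m) • K0Ab.mk (image f) := by
  let _ : F.ShiftSequence ℤ := Functor.ShiftSequence.tautological F ℤ
  have hk : K0Ab.mk (kernel g) = K0Ab.mk (kernel ((F.shift (((0 : ℕ) : ℤ))).map Tr.mor₁)) := by
    subst hg
    refine K0Ab.mk_eq_of_iso (kernel.mapIso _ _ ((F.isoShiftZero ℤ).symm.app _)
      ((F.isoShiftZero ℤ).symm.app _) ?_)
    exact (F.isoShiftZero ℤ).inv.naturality _
  have hi : K0Ab.mk (image f) = K0Ab.mk (kernel ((F.shift (m : ℤ)).map Tr.mor₁)) := by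
    have hm : (m : ℤ) - 1 + 1 = m := by ring
    have h1 := K0Ab.mk_exact _ _ _ (F.homologySequence_exact₁ Tr hTr ((m : ℤ) - 1) m hm)
    have h2 := K0Ab.mk_kernel f (factorThruImage f) (image.ι f) (image.fac f)
    have hd : F.homologySequenceδ Tr ((m : ℤ) - 1) m hm = F.map (Tr.mor₃⟦(m : ℤ) - 1⟧') ≫
        𝟙 _ ≫ F.map ((shiftFunctorAdd' T 1 ((m : ℤ) - 1) (m : ℤ) (by ring)).inv.app Tr.obj₁) := rfl
    have h3 : K0Ab.mk (kernel f) =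
        K0Ab.mk (kernel (F.homologySequenceδ Tr ((m : ℤ) - 1) m hm)) := by
      refine K0Ab.mk_kernel_comp_iso f _ (e.app Tr.obj₁) ?_
      rw [hf, hd, F.map_comp, Category.id_comp]
      rfl
    rw [h3] at h2
    exact add_left_cancel (h2.symm.trans h1)
  rw [hk, hi]
  refine K0Ab.telescope (fun i => K0Ab.mk (F.obj (Tr.obj₁⟦(i : ℤ)⟧)))
    (fun i => K0Ab.mk (F.obj (Tr.obj₂⟦(i : ℤ)⟧))) (fun i => K0Ab.mk (F.obj (Tr.obj₃⟦(i : ℤ)⟧)))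
    (fun i => K0Ab.mk (kernel ((F.shift (i : ℤ)).map Tr.mor₁))) (fun n => ?_) m
  have hn : (n : ℤ) + 1 = ((n + 1 : ℕ) : ℤ) := by push_cast; ring
  have h1 := K0Ab.mk_exact _ _ _ (F.homologySequence_exact₂ Tr hTr (n : ℤ))
  have h2 := K0Ab.mk_exact _ _ _ (F.homologySequence_exact₃ Tr hTr (n : ℤ) _ hn)
  have h3 := K0Ab.mk_exact _ _ _ (F.homologySequence_exact₁ Tr hTr (n : ℤ) _ hn)
  change K0Ab.mk ((F.shift (n : ℤ)).obj Tr.obj₁) - K0Ab.mk ((F.shift (n : ℤ)).obj Tr.obj₂) +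
    K0Ab.mk ((F.shift (n : ℤ)).obj Tr.obj₃) = _
  rw [h1, h2, h3]
  abel
end
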